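/- There is a constant C > 0, depending only on Q, such that for every natural number n the word w_n can be converted to the empty word by free reductions, free expansions and applications of relators of Q with every intermediate word of length at most C·2ⁿ; that is, FL(w_n) ≤ C·2ⁿ. -/

import Mathlib

/-! Words over an alphabet `A`: a letter `(x, true)` is the generator `x`,
and `(x, false)` is its formal inverse `x⁻¹`. -/

/-- A word over the alphabet `A ∪ A⁻¹`. -/
abbrev Word (A : Type*) := List (A × Bool)

namespace Word

/-- The formal inverse of a word. -/
def inv {A : Type*} (w : Word A) : Word A := (w.map fun p => (p.1, !p.2)).reverse

/-- `w'` is a cyclic conjugate (cyclic permutation) of `w`. -/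
def IsCyclicConj {A : Type*} (w w' : Word A) : Prop :=
  ∃ u v : Word A, w = u ++ v ∧ w' = v ++ u

end Word

/-- Moves (i)–(iii) on words with respect to a set `R` of relator words:
free reduction, free expansion, and application of a relator (replace a subword `u`
by `v` where some cyclic conjugate of `u * v⁻¹` lies in `R ∪ R⁻¹`). -/
inductive Move {A : Type*} (R : Set (Word A)) : Word A → Word A → Prop
  | freeReduce (u v : Word A) (x : A) (b : Bool) :
      Move R (u ++ (x, b) :: (x, !b) :: v) (u ++ v)
  | freeExpand (u v : Word A) (x : A) (b : Bool) :
      Move R (u ++ v) (u ++ (x, b) :: (x, !b) :: v)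
  | relator (p q u v z : Word A)
      (hz : Word.IsCyclicConj (u ++ Word.inv v) z) (hR : z ∈ R ∨ Word.inv z ∈ R) :
      Move R (p ++ u ++ q) (p ++ v ++ q)

/-- Moves (i)–(iv): moves (i)–(iii) together with cyclic conjugation. -/
inductive MoveC {A : Type*} (R : Set (Word A)) : Word A → Word A → Prop
  | of {w w' : Word A} : Move R w w' → MoveC R w w'
  | cyc {w w' : Word A} : Word.IsCyclicConj w w' → MoveC R w w'

/-- Moves (i)–(v) on finite sequences of words: one of the moves (i)–(iv) applied to
one word of the sequence, or fragmentation of one word `u ++ v` into `u` and `v`. -/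
inductive MoveF {A : Type*} (R : Set (Word A)) : List (Word A) → List (Word A) → Prop
  | of (l₁ l₂ : List (Word A)) {w w' : Word A} :
      MoveC R w w' → MoveF R (l₁ ++ w :: l₂) (l₁ ++ w' :: l₂)
  | frag (l₁ l₂ : List (Word A)) (u v : Word A) :
      MoveF R (l₁ ++ (u ++ v) :: l₂) (l₁ ++ u :: v :: l₂)

/-- A word is null-homotopic over the presentation with relator set `R` if it represents
the identity of the presented group, i.e. lies in the normal closure of the relators. -/
def NullHomotopic {A : Type*} (R : Set (Word A)) (w : Word A) : Prop :=
  FreeGroup.mk w ∈ Subgroup.normalClosure (FreeGroup.mk '' R)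

/-- `FLle R w L`: the word `w` can be converted to the empty word by moves (i)–(iii)
with every intermediate word of length at most `L`. -/
def FLle {A : Type*} (R : Set (Word A)) (w : Word A) (L : ℕ) : Prop :=
  ∃ (m : ℕ) (f : ℕ → Word A), f 0 = w ∧ f m = [] ∧
    (∀ i < m, Move R (f i) (f (i + 1))) ∧ ∀ i ≤ m, (f i).length ≤ L

/-- `FFLle R w L`: the word `w` can be converted to the empty word by moves (i)–(iv)
with every intermediate word of length at most `L`. -/
def FFLle {A : Type*} (R : Set (Word A)) (w : Word A) (L : ℕ) : Prop :=
  ∃ (m : ℕ) (f : ℕ → Word A), f 0 = w ∧ f m = [] ∧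
    (∀ i < m, MoveC R (f i) (f (i + 1))) ∧ ∀ i ≤ m, (f i).length ≤ L

/-- The total length of a finite sequence of words. -/
def totalLength {A : Type*} (l : List (Word A)) : ℕ := (l.map List.length).sum

/-- `FFFLle R w L`: the length-one sequence `(w)` can be converted to a sequence of empty
words by moves (i)–(v) with every intermediate sequence of total length at most `L`. -/
def FFFLle {A : Type*} (R : Set (Word A)) (w : Word A) (L : ℕ) : Prop :=
  ∃ (m : ℕ) (f : ℕ → List (Word A)), f 0 = [w] ∧ (∀ u ∈ f m, u = ([] : Word A)) ∧
    (∀ i < m, MoveF R (f i) (f (i + 1))) ∧ ∀ i ≤ m, totalLength (f i) ≤ L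

/-- An element `x` of the free group is a conjugate of a relator of `R` or of an inverse
of a relator. -/
def IsConjRelator {A : Type*} (R : Set (Word A)) (x : FreeGroup A) : Prop :=
  ∃ c ρ : FreeGroup A, (ρ ∈ FreeGroup.mk '' R ∨ ρ⁻¹ ∈ FreeGroup.mk '' R) ∧ x = c * ρ * c⁻¹

/-- `AreaLe R g N`: in the free group, `g` is a product of at most `N` conjugates
of elements of `R ∪ R⁻¹`. -/
def AreaLe {A : Type*} (R : Set (Word A)) (g : FreeGroup A) (N : ℕ) : Prop :=
  ∃ l : List (FreeGroup A), l.length ≤ N ∧ (∀ x ∈ l, IsConjRelator R x) ∧ l.prod = g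

/-- The number of occurrences in `w` of the letter `x` or its inverse. -/
def countLtr {A : Type*} [DecidableEq A] (x : A) (w : Word A) : ℕ :=
  (w.filter fun p => p.1 = x).length

/-- The filling length `FL(w)` of a null-homotopic word. -/
noncomputable def FLw {A : Type*} (R : Set (Word A)) (w : Word A) : ℕ :=
  sInf {L | FLle R w L}

/-- The free filling length `FFL(w)` of a null-homotopic word. -/
noncomputable def FFLw {A : Type*} (R : Set (Word A)) (w : Word A) : ℕ :=
  sInf {L | FFLle R w L}

/-- The fragmenting free filling length `FFFL(w)` of a null-homotopic word. -/
noncomputable def FFFLw {A : Type*} (R : Set (Word A)) (w : Word A) : ℕ :=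
  sInf {L | FFFLle R w L}

/-- The filling length function `FL : ℕ → ℕ` of the presentation with relators `R`. -/
noncomputable def FLfn {A : Type*} (R : Set (Word A)) (n : ℕ) : ℕ :=
  sSup (FLw R '' {w | NullHomotopic R w ∧ w.length ≤ n})

/-- The free filling length function `FFL : ℕ → ℕ`. -/
noncomputable def FFLfn {A : Type*} (R : Set (Word A)) (n : ℕ) : ℕ :=
  sSup (FFLw R '' {w | NullHomotopic R w ∧ w.length ≤ n})

/-- The fragmenting free filling length function `FFFL : ℕ → ℕ`. -/
noncomputable def FFFLfn {A : Type*} (R : Set (Word A)) (n : ℕ) : ℕ :=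
  sSup (FFFLw R '' {w | NullHomotopic R w ∧ w.length ≤ n})

/-! The presentation `Q = ⟨a, b, r, s, t | a^b a⁻², [t,a], [r,at], [r,s], [s,t]⟩`. -/

/-- The five generators of the presentation `Q`. -/
inductive QGen | a | b | r | s | t
deriving DecidableEq

/-- The five relators of `Q`: `b⁻¹aba⁻¹a⁻¹`, `t⁻¹a⁻¹ta`, `r⁻¹t⁻¹a⁻¹rat`,
`r⁻¹s⁻¹rs`, `s⁻¹t⁻¹st`. -/
def QRels : Set (Word QGen) :=
  { [(QGen.b, false), (QGen.a, true), (QGen.b, true), (QGen.a, false), (QGen.a, false)],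
    [(QGen.t, false), (QGen.a, false), (QGen.t, true), (QGen.a, true)],
    [(QGen.r, false), (QGen.t, false), (QGen.a, false), (QGen.r, true), (QGen.a, true),
      (QGen.t, true)],
    [(QGen.r, false), (QGen.s, false), (QGen.r, true), (QGen.s, true)],
    [(QGen.s, false), (QGen.t, false), (QGen.s, true), (QGen.t, true)] }

/-- The word `bⁿ`. -/
def bpow (n : ℕ) : Word QGen := List.replicate n (QGen.b, true)

/-- The word `b⁻ⁿ`. -/
def bpowInv (n : ℕ) : Word QGen := List.replicate n (QGen.b, false)

/-- The word `a^{-bⁿ} = b⁻ⁿ a⁻¹ bⁿ`. -/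
def aConjNeg (n : ℕ) : Word QGen := bpowInv n ++ [(QGen.a, false)] ++ bpow n

/-- The word `a^{bⁿ} = b⁻ⁿ a bⁿ`. -/
def aConjPos (n : ℕ) : Word QGen := bpowInv n ++ [(QGen.a, true)] ++ bpow n

/-- The word `a^{-bⁿ} r a^{bⁿ}`. -/
def gword (n : ℕ) : Word QGen := aConjNeg n ++ [(QGen.r, true)] ++ aConjPos n

/-- The word `w_n = [s, a^{-bⁿ} r a^{bⁿ}] = s⁻¹ (b⁻ⁿa⁻¹bⁿ r b⁻ⁿabⁿ)⁻¹ s (b⁻ⁿa⁻¹bⁿ r b⁻ⁿabⁿ)`. -/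
def wn (n : ℕ) : Word QGen :=
  [(QGen.s, false)] ++ Word.inv (gword n) ++ [(QGen.s, true)] ++ gword n

/-- The word `a^{-bⁿ} r a^{bⁿ} r a^{bⁿ} r⁻¹ a^{-bⁿ}`. -/
def g'word (n : ℕ) : Word QGen :=
  aConjNeg n ++ [(QGen.r, true)] ++ aConjPos n ++ [(QGen.r, true)] ++ aConjPos n ++
    [(QGen.r, false)] ++ aConjNeg n

/-- The word `w'_n = [s, a^{-bⁿ} r a^{bⁿ} r a^{bⁿ} r⁻¹ a^{-bⁿ}]`. -/
def w'n (n : ℕ) : Word QGen :=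
  [(QGen.s, false)] ++ Word.inv (g'word n) ++ [(QGen.s, true)] ++ g'word n

theorem Word.inv_append {A : Type*} (u v : Word A) :
    Word.inv (u ++ v) = Word.inv v ++ Word.inv u := by
  simp [Word.inv]

theorem Word.inv_inv {A : Type*} (u : Word A) : Word.inv (Word.inv u) = u := by
  simp [Word.inv, Function.comp_def]

theorem Word.length_inv {A : Type*} (u : Word A) : (Word.inv u).length = u.length := by
  simp [Word.inv]

namespace Move

variable {A : Type*} {R : Set (Word A)} {w w' : Word A}

theorem symm (h : Move R w w') : Move R w' w := by
  cases h with
  | freeReduce u v x b => exact .freeExpand u v x b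
  | freeExpand u v x b => exact .freeReduce u v x b
  | relator p q u v z hz hR =>
    obtain ⟨x, y, hxy, rfl⟩ := hz
    refine .relator p q v u (Word.inv (y ++ x)) ⟨Word.inv y, Word.inv x, ?_, ?_⟩ ?_
    · rw [← Word.inv_append, ← hxy, Word.inv_append, Word.inv_inv]
    · rw [Word.inv_append]
    · rw [Word.inv_inv]
      exact hR.symm

theorem context (p q : Word A) (h : Move R w w') : Move R (p ++ w ++ q) (p ++ w' ++ q) := by
  cases h with
  | freeReduce u v x b => simpa using Move.freeReduce (R := R) (p ++ u) (v ++ q) x b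
  | freeExpand u v x b => simpa using Move.freeExpand (R := R) (p ++ u) (v ++ q) x b
  | relator p' q' u v z hz hR =>
    simpa using Move.relator (R := R) (p ++ p') (q' ++ q) u v z hz hR

end Move

/-- `u` can be converted to `v` by moves (i)–(iii) through words of length at most `L`. -/
def Derives {A : Type*} (R : Set (Word A)) (L : ℕ) : Word A → Word A → Prop :=
  Relation.ReflTransGen fun u v => Move R u v ∧ u.length ≤ L ∧ v.length ≤ L

namespace Derives

variable {A : Type*} {R : Set (Word A)} {L L' : ℕ} {u v w : Word A}

theorem refl (u : Word A) : Derives R L u u := Relation.ReflTransGen.refl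

theorem trans (h : Derives R L u v) (h' : Derives R L v w) : Derives R L u w :=
  Relation.ReflTransGen.trans h h'

theorem of_move (h : Move R u v) (hu : u.length ≤ L) (hv : v.length ≤ L) : Derives R L u v :=
  Relation.ReflTransGen.single ⟨h, hu, hv⟩

theorem mono (hL : L ≤ L') (h : Derives R L u v) : Derives R L' u v :=
  Relation.ReflTransGen.mono (fun _ _ h => ⟨h.1, h.2.1.trans hL, h.2.2.trans hL⟩) _ _ h

theorem symm (h : Derives R L u v) : Derives R L v u := by
  induction h with
  | refl => exact refl _
  | tail _ h ih => exact (of_move h.1.symm h.2.2 h.2.1).trans ih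

theorem context (p q : Word A) (h : Derives R L u v) (hL : p.length + L + q.length ≤ L') :
    Derives R L' (p ++ u ++ q) (p ++ v ++ q) := by
  refine Relation.ReflTransGen.lift (fun x => p ++ x ++ q) (fun x y hxy => ?_) _ _ h
  refine ⟨hxy.1.context p q, ?_, ?_⟩ <;> simp only [List.length_append] <;> omega

theorem flle (h : Derives R L w []) (hw : w.length ≤ L) : FLle R w L := by
  induction h using Relation.ReflTransGen.head_induction_on with
  | refl => exact ⟨0, fun _ => [], rfl, rfl, by simp, by simp⟩
  | @head u _ h _ ih =>
    obtain ⟨m, f, h0, hm, hmove, hlen⟩ := ih h.2.2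
    refine ⟨m + 1, fun i => Nat.casesOn i u f, rfl, hm, ?_, ?_⟩
    · rintro (_ | i) hi
      · simpa [h0] using h.1
      · exact hmove i (by omega)
    · rintro (_ | i) hi
      · exact h.2.1
      · exact hlen i (by omega)

/-- If `xy` can be replaced by `zᵐx`, then a letter `x` can be pushed through `yᵏ`. -/
theorem push {x y z : A × Bool} {m : ℕ} (h : Move R [x, y] (List.replicate m z ++ [x])) (k : ℕ) :
    Derives R (m * k + k + 2)
      (x :: List.replicate k y) (List.replicate (m * k) z ++ [x]) := by
  induction k with
  | zero => exact refl _
  | succ k ih =>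
    have h₁ : Derives R (m * (k + 1) + (k + 1) + 2) (x :: List.replicate (k + 1) y)
        (List.replicate m z ++ x :: List.replicate k y) := by
      refine of_move ?_ ?_ ?_
      · simpa [List.replicate_succ] using h.context [] (List.replicate k y)
      · simp; omega
      · simp; grind
    refine h₁.trans ?_
    have h₂ := ih.context (L' := m * (k + 1) + (k + 1) + 2) (List.replicate m z) [] (by
      simp; grind)
    have hz : List.replicate (m * (k + 1)) z = List.replicate m z ++ List.replicate (m * k) z := by
      rw [← List.replicate_add]
      congr 1
      ring
    rw [hz]
    simpa only [List.append_assoc, List.append_nil] using h₂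

theorem cancel (u : Word A) : Derives R (2 * u.length) (Word.inv u ++ u) [] := by
  induction u with
  | nil => exact refl _
  | cons x u ih =>
    refine Derives.trans ?_ (ih.mono (by simp))
    refine of_move ?_ ?_ ?_
    · simpa [Word.inv] using Move.freeReduce (R := R) (Word.inv u) u x.1 (!x.2)
    · simp [Word.length_inv]; omega
    · simp [Word.length_inv]; omega

end Derives

theorem QRels.move {u v x y : Word QGen} (hxy : u ++ Word.inv v = x ++ y)
    (h : y ++ x ∈ QRels ∨ Word.inv (y ++ x) ∈ QRels) : Move QRels u v := by
  simpa using Move.relator [] [] u v _ ⟨x, y, hxy, rfl⟩ h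

theorem QRels.move_b_a (e : Bool) : Move QRels [(QGen.b, false), (QGen.a, e)]
    (List.replicate 2 (QGen.a, e) ++ [(QGen.b, false)]) := by
  cases e
  · exact QRels.move (x := [(QGen.b, false), (QGen.a, false), (QGen.b, true)])
      (y := [(QGen.a, true), (QGen.a, true)]) rfl (by simp [QRels, Word.inv])
  · exact QRels.move (x := []) (y := [(QGen.b, false), (QGen.a, true), (QGen.b, true),
      (QGen.a, false), (QGen.a, false)]) rfl (by simp [QRels])

theorem QRels.move_a_inv_t : Move QRels [(QGen.a, false), (QGen.t, true)]
    (List.replicate 1 (QGen.t, true) ++ [(QGen.a, false)]) :=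
  QRels.move (x := [(QGen.a, false), (QGen.t, true), (QGen.a, true)])
    (y := [(QGen.t, false)]) rfl (by simp [QRels])

theorem QRels.move_a_t_inv : Move QRels [(QGen.a, true), (QGen.t, false)]
    (List.replicate 1 (QGen.t, false) ++ [(QGen.a, true)]) :=
  QRels.move (x := [(QGen.a, true)])
    (y := [(QGen.t, false), (QGen.a, false), (QGen.t, true)]) rfl (by simp [QRels])

theorem QRels.move_s_t (e : Bool) : Move QRels [(QGen.s, true), (QGen.t, e)]
    (List.replicate 1 (QGen.t, e) ++ [(QGen.s, true)]) := by
  cases e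
  · exact QRels.move (x := [(QGen.s, true)])
      (y := [(QGen.t, false), (QGen.s, false), (QGen.t, true)]) rfl (by simp [QRels, Word.inv])
  · exact QRels.move (x := [(QGen.s, true), (QGen.t, true)])
      (y := [(QGen.s, false), (QGen.t, false)]) rfl (by simp [QRels])

theorem QRels.move_s_r : Move QRels [(QGen.s, true), (QGen.r, true)]
    [(QGen.r, true), (QGen.s, true)] :=
  QRels.move (x := [(QGen.s, true), (QGen.r, true)])
    (y := [(QGen.s, false), (QGen.r, false)]) rfl (by simp [QRels, Word.inv])

theorem QRels.move_a_r_a : Move QRels [(QGen.a, false), (QGen.r, true), (QGen.a, true)]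
    [(QGen.t, true), (QGen.r, true), (QGen.t, false)] :=
  QRels.move (x := [(QGen.a, false), (QGen.r, true), (QGen.a, true), (QGen.t, true)])
    (y := [(QGen.r, false), (QGen.t, false)]) rfl (by simp [QRels])

theorem derives_aConj (e : Bool) (n : ℕ) : Derives QRels (6 * 2 ^ n + 2 * n)
    (bpowInv n ++ [(QGen.a, e)] ++ bpow n) (List.replicate (2 ^ n) (QGen.a, e)) := by
  induction n with
  | zero => exact .refl _
  | succ n ih =>
    have hpos := Nat.one_le_two_pow (n := n)
    have hpow : 2 ^ (n + 1) = 2 * 2 ^ n := by ring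
    have h₁ := ih.context (L' := 6 * 2 ^ (n + 1) + 2 * (n + 1))
      [(QGen.b, false)] [(QGen.b, true)] (by simp; omega)
    have h₂ := (Derives.push (QRels.move_b_a e) (2 ^ n)).context
      (L' := 6 * 2 ^ (n + 1) + 2 * (n + 1)) [] [(QGen.b, true)] (by simp; omega)
    have h₃ : Derives QRels (6 * 2 ^ (n + 1) + 2 * (n + 1))
        (List.replicate (2 * 2 ^ n) (QGen.a, e) ++ [(QGen.b, false), (QGen.b, true)])
        (List.replicate (2 * 2 ^ n) (QGen.a, e)) := by
      refine .of_move ?_ ?_ ?_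
      · simpa using Move.freeReduce (R := QRels)
          (List.replicate (2 * 2 ^ n) (QGen.a, e)) [] QGen.b false
      · simp; omega
      · simp; omega
    have h₄ := (h₁.trans (by simpa using h₂)).trans (by simpa using h₃)
    rw [← hpow] at h₄
    have hl : bpowInv (n + 1) = (QGen.b, false) :: bpowInv n := rfl
    have hr : bpow (n + 1) = bpow n ++ [(QGen.b, true)] := List.replicate_succ'
    rw [hl, hr]
    simpa using h₄

theorem derives_conj_a_conj_t (k : ℕ) : Derives QRels (4 * k + 10)
    (List.replicate k (QGen.a, false) ++ [(QGen.r, true)] ++ List.replicate k (QGen.a, true))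
    (List.replicate k (QGen.t, true) ++ [(QGen.r, true)] ++ List.replicate k (QGen.t, false)) := by
  induction k with
  | zero => exact .refl _
  | succ k ih =>
    have h₁ := ih.context (L' := 4 * (k + 1) + 10) [(QGen.a, false)] [(QGen.a, true)]
      (by simp; omega)
    have h₂ := (Derives.push QRels.move_a_inv_t k).context (L' := 4 * (k + 1) + 10) []
      ([(QGen.r, true)] ++ List.replicate k (QGen.t, false) ++ [(QGen.a, true)])
      (by simp; omega)
    have h₃ := (Derives.push QRels.move_a_t_inv k).symm.context (L' := 4 * (k + 1) + 10)
      (List.replicate k (QGen.t, true) ++ [(QGen.a, false), (QGen.r, true)]) []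
      (by simp; omega)
    have h₄ : Derives QRels (4 * (k + 1) + 10) _ _ :=
      .of_move (QRels.move_a_r_a.context
        (List.replicate k (QGen.t, true)) (List.replicate k (QGen.t, false)))
        (by simp; omega) (by simp; omega)
    have hl : ∀ x : QGen × Bool, List.replicate (k + 1) x = x :: List.replicate k x := fun _ => rfl
    rw [hl (QGen.a, false), hl (QGen.t, false), List.replicate_succ' (a := (QGen.a, true)),
      List.replicate_succ' (a := (QGen.t, true))]
    simp only [one_mul, List.append_assoc, List.cons_append, List.nil_append, List.append_nil]
      at h₁ h₂ h₃ h₄ ⊢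
    exact ((h₁.trans h₂).trans h₃).trans h₄

theorem derives_gword (n : ℕ) : Derives QRels (30 * 2 ^ n) (gword n)
    (List.replicate (2 ^ n) (QGen.t, true) ++ [(QGen.r, true)] ++
      List.replicate (2 ^ n) (QGen.t, false)) := by
  have hn : n < 2 ^ n := Nat.lt_two_pow_self
  have h₁ := (derives_aConj false n).context (L' := 30 * 2 ^ n) []
    ([(QGen.r, true)] ++ aConjPos n) (by simp [aConjPos, bpow, bpowInv]; omega)
  have h₂ := (derives_aConj true n).context (L' := 30 * 2 ^ n)
    (List.replicate (2 ^ n) (QGen.a, false) ++ [(QGen.r, true)]) [] (by simp; omega)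
  have h₃ := (derives_conj_a_conj_t (2 ^ n)).mono (L' := 30 * 2 ^ n) (by omega)
  simp only [gword, aConjNeg, aConjPos, List.append_assoc, List.nil_append, List.append_nil]
    at h₁ h₂ h₃ ⊢
  exact (h₁.trans h₂).trans h₃

theorem derives_s_conj_t (k : ℕ) : Derives QRels (4 * k + 10)
    ([(QGen.s, true)] ++ (List.replicate k (QGen.t, true) ++ [(QGen.r, true)] ++
      List.replicate k (QGen.t, false)))
    (List.replicate k (QGen.t, true) ++ [(QGen.r, true)] ++
      List.replicate k (QGen.t, false) ++ [(QGen.s, true)]) := by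
  have h₁ := (Derives.push (QRels.move_s_t true) k).context (L' := 4 * k + 10) []
    ([(QGen.r, true)] ++ List.replicate k (QGen.t, false)) (by simp; omega)
  have h₂ : Derives QRels (4 * k + 10) _ _ :=
    .of_move (QRels.move_s_r.context
      (List.replicate k (QGen.t, true)) (List.replicate k (QGen.t, false)))
      (by simp; omega) (by simp; omega)
  have h₃ := (Derives.push (QRels.move_s_t false) k).context (L' := 4 * k + 10)
    (List.replicate k (QGen.t, true) ++ [(QGen.r, true)]) [] (by simp; omega)
  simp only [one_mul, List.append_assoc, List.cons_append, List.nil_append, List.append_nil]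
    at h₁ h₂ h₃ ⊢
  exact (h₁.trans h₂).trans h₃

theorem length_gword (n : ℕ) : (gword n).length = 4 * n + 3 := by
  simp [gword, aConjNeg, aConjPos, bpow, bpowInv]; omega

theorem derives_wn (n : ℕ) : Derives QRels (50 * 2 ^ n) (wn n) [] := by
  have hn : n < 2 ^ n := Nat.lt_two_pow_self
  have hlen := length_gword n
  have hinv := Word.length_inv (gword n)
  have h₁ := (derives_gword n).context (L' := 50 * 2 ^ n)
    ([(QGen.s, false)] ++ Word.inv (gword n) ++ [(QGen.s, true)]) [] (by simp; omega)
  have h₂ := (derives_s_conj_t (2 ^ n)).context (L' := 50 * 2 ^ n)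
    ([(QGen.s, false)] ++ Word.inv (gword n)) [] (by simp; omega)
  have h₃ := (derives_gword n).symm.context (L' := 50 * 2 ^ n)
    ([(QGen.s, false)] ++ Word.inv (gword n)) [(QGen.s, true)] (by simp; omega)
  have h₄ := (Derives.cancel (R := QRels) (gword n)).context (L' := 50 * 2 ^ n)
    [(QGen.s, false)] [(QGen.s, true)] (by simp; omega)
  have h₅ := (Derives.cancel (R := QRels) [(QGen.s, true)]).mono (L' := 50 * 2 ^ n)
    (by simp; omega)
  simp only [wn, List.append_assoc, List.cons_append, List.nil_append, List.append_nil]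
    at h₁ h₂ h₃ h₄ ⊢
  exact (((h₁.trans h₂).trans h₃).trans h₄).trans h₅

theorem FL_wn_upper_bound :
    ∃ C : ℕ, 0 < C ∧ ∀ n : ℕ, FLle QRels (wn n) (C * 2 ^ n) := by
  refine ⟨50, by norm_num, fun n => (derives_wn n).flle ?_⟩
  have hn : n < 2 ^ n := Nat.lt_two_pow_self
  have hlen := length_gword n
  have hinv := Word.length_inv (gword n)
  simp only [wn, List.length_append, List.length_cons, List.length_nil]
  omega
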